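/- arXiv:2403.10523 — 2 statements merged into one kernel-verified Lean document; each statement's English description precedes it below -/
import Mathlib

section
/- Let U ⊆ ℂ be an open connected set, F : ℂ → ℂ a function holomorphic on U that is not constant on U, and K ⊆ U a compact set. If the imaginary part of F does not change sign on the boundary of K — that is, either Im(F(z)) ≥ 0 for all z in the frontier of K, or Im(F(z)) ≤ 0 for all z in the frontier of K — then Im(F(z)) ≠ 0 for every z in the interior of K; in particular, F(z) ≠ 0 for every z in the interior of K. -/
open Complex Topology

theorem im_pos_aux
    (U : Set ℂ) (hU : IsOpen U) (hUconn : IsConnected U)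
    (F : ℂ → ℂ) (hF : DifferentiableOn ℂ F U)
    (hFnc : ¬ ∃ c : ℂ, ∀ z ∈ U, F z = c)
    (K : Set ℂ) (hK : IsCompact K) (hKU : K ⊆ U)
    (hsign : ∀ z ∈ frontier K, 0 ≤ (F z).im) :
    ∀ z ∈ interior K, 0 < (F z).im := by
  have hop := ((hF.analyticOnNhd hU).is_constant_or_isOpen hUconn.isPreconnected).resolve_left hFnc
    (interior K) (interior_subset.trans hKU) isOpen_interior
  have key : ∀ z ∈ interior K, ∃ w ∈ interior K, (F w).im < (F z).im := by
    intro z hz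
    obtain ⟨r, hr, hb⟩ := Metric.isOpen_iff.1 hop (F z) ⟨z, hz, rfl⟩
    have hm : F z - ((r / 2 : ℝ) : ℂ) * I ∈ Metric.ball (F z) r := by
      rw [Metric.mem_ball, dist_eq_norm]
      simp [abs_of_pos hr]
      linarith
    obtain ⟨w, hw, h⟩ := hb hm
    refine ⟨w, hw, ?_⟩
    rw [h, sub_im, im_ofReal_mul, I_im]
    linarith
  intro z hz
  by_contra hn
  push Not at hn
  obtain ⟨w, hw, hwz⟩ := key z hz
  have hc : ContinuousOn (fun z => (F z).im) K :=
    continuous_im.comp_continuousOn (hF.continuousOn.mono hKU)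
  obtain ⟨m, hm, hmin⟩ := hK.exists_isMinOn ⟨w, interior_subset hw⟩ hc
  have h1 : (F m).im ≤ (F w).im := hmin (interior_subset hw)
  have hmi : m ∈ interior K := by
    by_contra hmi
    have := hsign m ⟨subset_closure hm, hmi⟩
    linarith
  obtain ⟨v, hv, hvm⟩ := key m hmi
  have h2 : (F m).im ≤ (F v).im := hmin (interior_subset hv)
  linarith

theorem im_zero_free_of_sign_on_frontier
    (U : Set ℂ) (hU : IsOpen U) (hUconn : IsConnected U)
    (F : ℂ → ℂ) (hF : DifferentiableOn ℂ F U)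
    (hFnc : ¬ ∃ c : ℂ, ∀ z ∈ U, F z = c)
    (K : Set ℂ) (hK : IsCompact K) (hKU : K ⊆ U)
    (hsign : (∀ z ∈ frontier K, 0 ≤ (F z).im) ∨ (∀ z ∈ frontier K, (F z).im ≤ 0)) :
    ∀ z ∈ interior K, (F z).im ≠ 0 ∧ F z ≠ 0 := by
  intro z hz
  suffices h : (F z).im ≠ 0 from ⟨h, fun h0 => h (by rw [h0, zero_im])⟩
  rcases hsign with h | h
  · exact (im_pos_aux U hU hUconn F hF hFnc K hK hKU h z hz).ne'
  · have := im_pos_aux U hU hUconn (fun z => -F z) hF.neg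
      (fun ⟨c, hc⟩ => hFnc ⟨-c, fun z hz => by rw [← hc z hz, neg_neg]⟩) K hK hKU
      (fun z hz => by simpa using h z hz) z hz
    rw [neg_im] at this
    intro h0
    linarith
end

section
/- Let U ⊆ ℂ be an open connected set, F : ℂ → ℂ a function holomorphic on U that is not constant on U, and K ⊆ U a compact set. If the real part of F does not change sign on the boundary of K — that is, either Re(F(z)) ≥ 0 for all z in the frontier of K, or Re(F(z)) ≤ 0 for all z in the frontier of K — then Re(F(z)) ≠ 0 for every z in the interior of K; in particular, F(z) ≠ 0 for every z in the interior of K. -/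
open Complex Topology

theorem re_pos_aux
    (U : Set ℂ) (hU : IsOpen U) (hUconn : IsConnected U)
    (F : ℂ → ℂ) (hF : DifferentiableOn ℂ F U)
    (hFnc : ¬ ∃ c : ℂ, ∀ z ∈ U, F z = c)
    (K : Set ℂ) (hK : IsCompact K) (hKU : K ⊆ U)
    (hsign : ∀ z ∈ frontier K, 0 ≤ (F z).re) :
    ∀ z ∈ interior K, (F z).re ≠ 0 := by
  intro z hz h0
  have hopen := ((hF.analyticOnNhd hU).is_constant_or_isOpen hUconn.isPreconnected).resolve_left hFnc
    (interior K) (interior_subset.trans hKU) isOpen_interior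
  have key : ∀ p ∈ interior K, ∃ q ∈ interior K, (F q).re < (F p).re := by
    intro p hp
    obtain ⟨e, he, hb⟩ := Metric.isOpen_iff.1 hopen (F p) ⟨p, hp, rfl⟩
    have hmem : F p - ((e / 2 : ℝ) : ℂ) ∈ Metric.ball (F p) e := by
      rw [Metric.mem_ball, dist_eq_norm, sub_sub_cancel_left, norm_neg, Complex.norm_real,
        Real.norm_of_nonneg (by positivity)]
      linarith
    obtain ⟨q, hq, hqe⟩ := hb hmem
    refine ⟨q, hq, ?_⟩
    rw [hqe, Complex.sub_re, Complex.ofReal_re]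
    linarith
  obtain ⟨w, hw, hmin⟩ := hK.exists_isMinOn ⟨z, interior_subset hz⟩
    (Complex.continuous_re.comp_continuousOn (hF.continuousOn.mono hKU))
  have hmin' : ∀ q ∈ K, (F w).re ≤ (F q).re := fun q hq => hmin hq
  obtain ⟨q, hq, hlt⟩ := key z hz
  have h1 := hmin' q (interior_subset hq)
  by_cases hwi : w ∈ interior K
  · obtain ⟨r, hr, hrl⟩ := key w hwi
    have := hmin' r (interior_subset hr)
    linarith
  · have := hsign w ⟨subset_closure hw, hwi⟩
    linarith

theorem re_zero_free_of_sign_on_frontier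
    (U : Set ℂ) (hU : IsOpen U) (hUconn : IsConnected U)
    (F : ℂ → ℂ) (hF : DifferentiableOn ℂ F U)
    (hFnc : ¬ ∃ c : ℂ, ∀ z ∈ U, F z = c)
    (K : Set ℂ) (hK : IsCompact K) (hKU : K ⊆ U)
    (hsign : (∀ z ∈ frontier K, 0 ≤ (F z).re) ∨ (∀ z ∈ frontier K, (F z).re ≤ 0)) :
    ∀ z ∈ interior K, (F z).re ≠ 0 ∧ F z ≠ 0 := by
  intro z hz
  have h : (F z).re ≠ 0 := by
    rcases hsign with h | h
    · exact re_pos_aux U hU hUconn F hF hFnc K hK hKU h z hz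
    · have := re_pos_aux U hU hUconn (fun z => - F z) hF.fun_neg
        (fun ⟨c, hc⟩ => hFnc ⟨-c, fun z hz => by rw [← hc z hz, neg_neg]⟩) K hK hKU
        (fun z hz => by simpa using h z hz) z hz
      simpa using this
  exact ⟨h, fun h0 => h (by rw [h0, Complex.zero_re])⟩
end
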